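/- arXiv:2412.00844 — 4 statements merged into one kernel-verified Lean document; each statement's English description precedes it below -/
import Mathlib

section
/- The 2-variable general-λ-matrix polynomials satisfy the difference summation formula: for all n ∈ ℕ and x, z ∈ ℂ, _Gλ_{n+1}^R(x + z) − _Gλ_{n+1}^R(x) = Σ_{j=1}^{n+1} ((n+1) choose j) z^j · _Gλ_{n+1-j}^R(x). -/
/-- The coefficients `c_R(j) = Γ(R+j+1)/Γ(2R+2j+1)` (scalar instance of the matrix parameter). -/
noncomputable def cR (R : ℂ) (j : ℕ) : ℂ :=
  Complex.Gamma (R + j + 1) / Complex.Gamma (2 * R + 2 * j + 1)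

/-- The 2-variable general polynomials `p_n(x) = Σ_{k=0}^n (n choose k) φ_k x^{n-k}`. -/
noncomputable def genPoly (φ : ℕ → ℂ) (n : ℕ) (x : ℂ) : ℂ :=
  ∑ k ∈ Finset.range (n + 1), (n.choose k : ℂ) * φ k * x ^ (n - k)

/-- The 2-variable general-λ-matrix polynomials
`_Glam_n^R(x) = Σ_{j=0}^n (n choose j) (-1)^j c_R(j) p_{n-j}(x)`. -/
noncomputable def Glam (R : ℂ) (φ : ℕ → ℂ) (n : ℕ) (x : ℂ) : ℂ :=
  ∑ j ∈ Finset.range (n + 1), (n.choose j : ℂ) * (-1) ^ j * cR R j * genPoly φ (n - j) x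

theorem choose_swap (n j k : ℕ) (h : j + k ≤ n) :
    (n.choose j : ℂ) * ((n - j).choose k : ℂ) = (n.choose k : ℂ) * ((n - k).choose j : ℂ) := by
  have h1 := Nat.choose_mul (n := n) (k := j + k) (s := j) (by omega)
  have h2 := Nat.choose_mul (n := n) (k := j + k) (s := k) (by omega)
  rw [Nat.add_sub_cancel_left] at h1
  rw [Nat.add_sub_cancel, ← Nat.choose_symm_add] at h2
  exact_mod_cast h1.symm.trans h2

theorem conv_swap (a b f : ℕ → ℂ) (n : ℕ) :
    ∑ j ∈ Finset.range (n + 1), (n.choose j : ℂ) * a j *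
      ∑ k ∈ Finset.range (n - j + 1), ((n - j).choose k : ℂ) * b k * f (n - j - k) =
    ∑ k ∈ Finset.range (n + 1), (n.choose k : ℂ) * b k *
      ∑ j ∈ Finset.range (n - k + 1), ((n - k).choose j : ℂ) * a j * f (n - k - j) := by
  simp only [Finset.mul_sum]
  rw [Finset.sum_comm' (t' := Finset.range (n + 1)) (s' := fun k => Finset.range (n - k + 1))]
  · refine Finset.sum_congr rfl fun k hk => Finset.sum_congr rfl fun j hj => ?_
    rw [Finset.mem_range] at hk hj
    have h := choose_swap n j k (by omega)
    rw [Nat.sub_right_comm n j k]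
    linear_combination a j * b k * f (n - k - j) * h
  · intro j k
    simp only [Finset.mem_range]
    omega

theorem genPoly_add (φ : ℕ → ℂ) (n : ℕ) (x z : ℂ) :
    genPoly φ n (x + z) =
      ∑ j ∈ Finset.range (n + 1), (n.choose j : ℂ) * z ^ j * genPoly φ (n - j) x := by
  unfold genPoly
  rw [conv_swap (fun j => z ^ j) φ (fun m => x ^ m) n]
  refine Finset.sum_congr rfl fun k _ => ?_
  rw [add_comm x z, add_pow]
  congr 1
  exact Finset.sum_congr rfl fun j _ => by ring

theorem Glam_add (R : ℂ) (φ : ℕ → ℂ) (n : ℕ) (x z : ℂ) :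
    Glam R φ n (x + z) =
      ∑ j ∈ Finset.range (n + 1), (n.choose j : ℂ) * z ^ j * Glam R φ (n - j) x := by
  have h := conv_swap (fun j => (-1) ^ j * cR R j) (fun j => z ^ j) (fun m => genPoly φ m x) n
  simp only [← genPoly_add, ← mul_assoc] at h
  simpa only [Glam] using h

/-- Difference summation formula:
`_Glam_{n+1}^R(x+z) − _Glam_{n+1}^R(x) = Σ_{j=1}^{n+1} ((n+1) choose j) z^j _Glam_{n+1-j}^R(x)`. -/
theorem Glam_diff (R : ℂ) (hR : 0 < R.re) (φ : ℕ → ℂ) (n : ℕ) (x z : ℂ) :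
    Glam R φ (n + 1) (x + z) - Glam R φ (n + 1) x =
      ∑ j ∈ Finset.Icc 1 (n + 1), ((n + 1).choose j : ℂ) * z ^ j * Glam R φ (n + 1 - j) x := by
  rw [Glam_add, Finset.range_eq_Ico, Finset.sum_eq_sum_Ico_succ_bot (by omega)]
  simp only [Nat.choose_zero_right, Nat.cast_one, pow_zero, one_mul, Nat.sub_zero,
    add_sub_cancel_left, zero_add]
  rfl
end

section
/- The 2-variable general-λ-matrix polynomials admit the determinant representation: for every n ≥ 1 and x ∈ ℂ, _Gλ_n^R(x) = ((-1)^n / γ_0^{n+1}) · det M, where M is the (n+1)×(n+1) complex matrix (indexed by i, j ∈ {0,…,n}) with first row M(0,j) = λ_j^R(x) (so in particular M(0,0) = Γ(R+1)/Γ(2R+1)), and for 1 ≤ i ≤ n: M(i,j) = (j choose (i−1)) γ_{j−i+1} if j ≥ i−1, and M(i,j) = 0 if j < i−1. -/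
/-- The 1-variable λ-matrix polynomials
`λ_n^R(x) = n! Σ_{j=0}^n (-1)^j c_R(j) x^{n-j}/(j!(n-j)!)`. -/
noncomputable def lamPoly (R : ℂ) (n : ℕ) (x : ℂ) : ℂ :=
  (n.factorial : ℂ) * ∑ j ∈ Finset.range (n + 1),
    (-1) ^ j * cR R j * x ^ (n - j) / ((j.factorial : ℂ) * ((n - j).factorial : ℂ))

noncomputable def egfE (a : ℕ → ℂ) : PowerSeries ℂ := PowerSeries.mk fun n => a n / (n.factorial : ℂ)

noncomputable def bconv (a b : ℕ → ℂ) (n : ℕ) : ℂ :=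
  ∑ k ∈ Finset.range (n + 1), (n.choose k : ℂ) * a k * b (n - k)

lemma egfE_bconv (a b : ℕ → ℂ) : egfE (bconv a b) = egfE a * egfE b := by
  ext n
  rw [PowerSeries.coeff_mul, Finset.Nat.sum_antidiagonal_eq_sum_range_succ_mk]
  simp only [egfE, PowerSeries.coeff_mk, bconv, Finset.sum_div]
  refine Finset.sum_congr rfl fun k hk => ?_
  have hk' : k ≤ n := by simpa [Nat.lt_succ_iff] using hk
  rw [Nat.cast_choose ℂ hk']
  have h1 : (n.factorial : ℂ) ≠ 0 := by exact_mod_cast n.factorial_ne_zero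
  have h2 : (k.factorial : ℂ) ≠ 0 := by exact_mod_cast k.factorial_ne_zero
  have h3 : ((n - k).factorial : ℂ) ≠ 0 := by exact_mod_cast (n - k).factorial_ne_zero
  field_simp

lemma egfE_inj {a b : ℕ → ℂ} (h : egfE a = egfE b) : a = b := by
  funext n
  have := congrArg (PowerSeries.coeff n) h
  simp only [egfE, PowerSeries.coeff_mk] at this
  have h1 : (n.factorial : ℂ) ≠ 0 := by exact_mod_cast n.factorial_ne_zero
  exact (div_left_inj' h1).mp this

lemma egf_inv (φ : ℕ → ℂ) (hφ : φ 0 ≠ 0) (γ : ℕ → ℂ)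
    (hγ0 : γ 0 = 1 / φ 0)
    (hγ : ∀ n, 1 ≤ n →
      γ n = -(1 / φ 0) * ∑ j ∈ Finset.Icc 1 n, (n.choose j : ℂ) * φ j * γ (n - j)) :
    egfE φ * egfE γ = 1 := by
  rw [← egfE_bconv]
  ext n
  simp only [egfE, PowerSeries.coeff_mk, PowerSeries.coeff_one]
  rcases Nat.eq_zero_or_pos n with rfl | hn
  · simp [bconv, hγ0, hφ]
  · have : bconv φ γ n = 0 := by
      have e : Finset.range (n + 1) = insert 0 (Finset.Icc 1 n) := by
        ext k; simp; omega
      rw [bconv, e, Finset.sum_insert (by simp)]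
      have := hγ n hn
      generalize (∑ j ∈ Finset.Icc 1 n, (n.choose j : ℂ) * φ j * γ (n - j)) = S at *
      simp [this]
      field_simp
      ring
    simp [this, hn.ne']

lemma lam_expand (R : ℂ) (φ : ℕ → ℂ) (hφ : φ 0 ≠ 0) (γ : ℕ → ℂ)
    (hγ0 : γ 0 = 1 / φ 0)
    (hγ : ∀ n, 1 ≤ n →
      γ n = -(1 / φ 0) * ∑ j ∈ Finset.Icc 1 n, (n.choose j : ℂ) * φ j * γ (n - j))
    (x : ℂ) (n : ℕ) :
    lamPoly R n x = bconv (fun k => Glam R φ k x) γ n := by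
  set c : ℕ → ℂ := fun j => (-1) ^ j * cR R j with hc
  have h1 : (fun n => genPoly φ n x) = bconv φ (fun n => x ^ n) := rfl
  have h2 : (fun n => Glam R φ n x) = bconv c (fun n => genPoly φ n x) := by
    funext n
    simp only [Glam, bconv, hc, mul_assoc]
  have h3 : (fun n => lamPoly R n x) = bconv c (fun n => x ^ n) := by
    funext n
    simp only [lamPoly, bconv, hc, Finset.mul_sum]
    refine Finset.sum_congr rfl fun k hk => ?_
    have hk' : k ≤ n := by simpa [Nat.lt_succ_iff] using hk
    rw [Nat.cast_choose ℂ hk']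
    ring
  refine congrFun (f := fun n => lamPoly R n x) (egfE_inj ?_) n
  have := egf_inv φ hφ γ hγ0 hγ
  change egfE _ = egfE (bconv _ γ)
  rw [egfE_bconv, h2, h3, egfE_bconv, egfE_bconv, h1, egfE_bconv]
  linear_combination (-(egfE c * egfE fun n => x ^ n)) * this

lemma shift_det (n : ℕ) (g : ℕ → ℂ) :
    Matrix.det (Matrix.of fun i k : Fin (n + 1) =>
      if (i : ℕ) = 0 then g k else if (i : ℕ) = k + 1 then 1 else 0) = (-1) ^ n * g n := by
  rw [Matrix.det_succ_column _ (Fin.last n), Finset.sum_eq_single 0]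
  · have : (Matrix.of fun i k : Fin (n + 1) =>
      if (i : ℕ) = 0 then g k else if (i : ℕ) = k + 1 then 1 else 0).submatrix
        (Fin.succAbove 0) (Fin.succAbove (Fin.last n)) = (1 : Matrix (Fin n) (Fin n) ℂ) := by
      ext i j
      simp only [Matrix.submatrix_apply, Matrix.of_apply, Matrix.one_apply, Fin.succAbove_zero,
        Fin.succAbove_last, Fin.val_succ, Fin.val_castSucc, Fin.ext_iff, Nat.succ_ne_zero, if_false,
        Nat.add_right_cancel_iff]
    rw [this]
    simp
  · intro i _ hi
    have h0 : (i : ℕ) ≠ 0 := fun h => hi (Fin.ext h)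
    have h1 : (i : ℕ) ≠ n + 1 := by omega
    simp only [Matrix.of_apply, Fin.val_last, if_neg h0, if_neg h1, mul_zero, zero_mul]
  · simp

lemma tri_det (n : ℕ) (γ : ℕ → ℂ) :
    Matrix.det (Matrix.of fun k j : Fin (n + 1) =>
      (((j : ℕ).choose k : ℕ) : ℂ) * γ (j - k)) = γ 0 ^ (n + 1) := by
  rw [Matrix.det_of_isUpperTriangular]
  · simp
  · intro i j hij
    have : (j : ℕ) < i := hij
    simp [Nat.choose_eq_zero_of_lt this]

/-- Determinant representation of the 2-variable general-λ-matrix polynomials: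
for `n ≥ 1`, `_Glam_n^R(x) = ((-1)^n/γ_0^{n+1}) det M`, where the first row of `M` is
`λ_0^R(x) = Γ(R+1)/Γ(2R+1), λ_1^R(x), …, λ_n^R(x)` and row `i ≥ 1` has entries
`M(i,j) = (j choose (i-1)) γ_{j-i+1}` for `j ≥ i-1` and 0 otherwise. -/
theorem Glam_det (R : ℂ) (hR : 0 < R.re) (φ : ℕ → ℂ) (hφ : φ 0 ≠ 0) (γ : ℕ → ℂ)
    (hγ0 : γ 0 = 1 / φ 0)
    (hγ : ∀ n, 1 ≤ n →
      γ n = -(1 / φ 0) * ∑ j ∈ Finset.Icc 1 n, (n.choose j : ℂ) * φ j * γ (n - j))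
    (n : ℕ) (hn : 1 ≤ n) (x : ℂ) :
    Glam R φ n x = ((-1) ^ n / (γ 0) ^ (n + 1)) *
      Matrix.det (Matrix.of fun i j : Fin (n + 1) =>
        if (i : ℕ) = 0 then lamPoly R (j : ℕ) x
        else if (i : ℕ) - 1 ≤ (j : ℕ) then
          ((j : ℕ).choose ((i : ℕ) - 1) : ℂ) * γ ((j : ℕ) + 1 - (i : ℕ))
        else 0) := by
  have hg : γ 0 ≠ 0 := by rw [hγ0]; exact one_div_ne_zero hφ
  have key : (Matrix.of fun i j : Fin (n + 1) =>
        if (i : ℕ) = 0 then lamPoly R (j : ℕ) x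
        else if (i : ℕ) - 1 ≤ (j : ℕ) then
          ((j : ℕ).choose ((i : ℕ) - 1) : ℂ) * γ ((j : ℕ) + 1 - (i : ℕ))
        else 0) =
      (Matrix.of fun i k : Fin (n + 1) =>
        if (i : ℕ) = 0 then (fun k => Glam R φ k x) k else if (i : ℕ) = k + 1 then 1 else 0) *
      (Matrix.of fun k j : Fin (n + 1) =>
        (((j : ℕ).choose k : ℕ) : ℂ) * γ (j - k)) := by
    ext i j
    rw [Matrix.mul_apply]
    simp only [Matrix.of_apply]
    by_cases h0 : (i : ℕ) = 0
    · simp only [h0, if_true]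
      rw [lam_expand R φ hφ γ hγ0 hγ, bconv,
        Fin.sum_univ_eq_sum_range (fun k => Glam R φ k x * (((j : ℕ).choose k : ℂ) * γ (j - k)))]
      rw [← Finset.sum_subset (Finset.range_mono (show (j : ℕ) + 1 ≤ n + 1 by omega))]
      · exact Finset.sum_congr rfl fun k _ => by ring
      · intro k _ hk
        have : (j : ℕ) < k := by simp at hk; omega
        simp [Nat.choose_eq_zero_of_lt this]
    · simp only [h0, if_false]
      rw [Finset.sum_eq_single (⟨(i : ℕ) - 1, by omega⟩ : Fin (n + 1))]
      · have e : (i : ℕ) = (i : ℕ) - 1 + 1 := by omega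
        rw [if_pos e, one_mul]
        split_ifs with h
        · congr 2; simp only []; omega
        · simp [Nat.choose_eq_zero_of_lt (not_le.mp h)]
      · intro k _ hk
        have : (i : ℕ) ≠ k + 1 := by
          intro h; apply hk; ext; simp; omega
        simp [this]
      · simp
  rw [key, Matrix.det_mul, shift_det n (fun k => Glam R φ k x), tri_det]
  have : ((-1 : ℂ) ^ n) * (-1) ^ n = 1 := by rw [← mul_pow]; simp
  field_simp
  linear_combination (-Glam R φ n x) * this
end

section
/- The Gould–Hopper-λ-matrix polynomials satisfy the summation formula: for all n ∈ ℕ and x, y, z ∈ ℂ, _{H^m}λ_n^R(x + z, y) = Σ_{j=0}^n (n choose j) z^j · _{H^m}λ_{n-j}^R(x, y). -/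
/-- The Gould–Hopper polynomials `H_n^{(m)}(x,y) = n! Σ_{j=0}^{⌊n/m⌋} y^j x^{n-mj}/(j!(n-mj)!)`. -/
noncomputable def gouldHopper (m n : ℕ) (x y : ℂ) : ℂ :=
  (n.factorial : ℂ) * ∑ j ∈ Finset.range (n / m + 1),
    y ^ j * x ^ (n - m * j) / ((j.factorial : ℂ) * ((n - m * j).factorial : ℂ))

/-- The Gould–Hopper-λ-matrix polynomials
`_{H^m}λ_n^R(x,y) = Σ_{j=0}^n (n choose j) (-1)^j c_R(j) H_{n-j}^{(m)}(x,y)`. -/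
noncomputable def GHlam (R : ℂ) (m n : ℕ) (x y : ℂ) : ℂ :=
  ∑ j ∈ Finset.range (n + 1), (n.choose j : ℂ) * (-1) ^ j * cR R j * gouldHopper m (n - j) x y

noncomputable def egf (f : ℕ → ℂ) : PowerSeries ℂ := PowerSeries.mk fun n => f n / (n.factorial : ℂ)

lemma egf_inj {f g : ℕ → ℂ} (h : egf f = egf g) (n : ℕ) : f n = g n := by
  have h1 := congrArg (PowerSeries.coeff n) h
  simp only [egf, PowerSeries.coeff_mk] at h1
  have : (n.factorial : ℂ) ≠ 0 := by exact_mod_cast n.factorial_ne_zero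
  field_simp at h1
  exact h1

lemma egf_mul (f g : ℕ → ℂ) : egf f * egf g =
    egf fun n => ∑ j ∈ Finset.range (n + 1), (n.choose j : ℂ) * f j * g (n - j) := by
  ext n
  simp only [egf, PowerSeries.coeff_mul, PowerSeries.coeff_mk]
  rw [Finset.Nat.sum_antidiagonal_eq_sum_range_succ
    (fun i j => f i / (i.factorial : ℂ) * (g j / (j.factorial : ℂ))), Finset.sum_div]
  refine Finset.sum_congr rfl fun j hj => ?_
  have hj' : j ≤ n := by simpa [Nat.lt_succ_iff] using hj
  rw [Nat.cast_choose ℂ hj']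
  have h1 : (n.factorial : ℂ) ≠ 0 := by exact_mod_cast n.factorial_ne_zero
  have h2 : (j.factorial : ℂ) ≠ 0 := by exact_mod_cast j.factorial_ne_zero
  have h3 : ((n-j).factorial : ℂ) ≠ 0 := by exact_mod_cast (n-j).factorial_ne_zero
  field_simp

lemma egf_gh (m : ℕ) (hm : 1 ≤ m) (x y : ℂ) :
    egf (fun n => gouldHopper m n x y) =
      PowerSeries.mk (fun k => if m ∣ k then y ^ (k / m) / ((k / m).factorial : ℂ) else 0)
        * egf (fun n => x ^ n) := by
  ext n
  simp only [egf, PowerSeries.coeff_mul, PowerSeries.coeff_mk, gouldHopper]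
  rw [Finset.Nat.sum_antidiagonal_eq_sum_range_succ
    (fun k j => (if m ∣ k then y ^ (k / m) / ((k / m).factorial : ℂ) else 0)
      * (x ^ j / (j.factorial : ℂ)))]
  have h1 : (n.factorial : ℂ) ≠ 0 := by exact_mod_cast n.factorial_ne_zero
  rw [mul_div_cancel_left₀ _ h1]
  simp only [ite_mul, zero_mul]
  rw [← Finset.sum_filter]
  refine Finset.sum_bij (fun j _ => m * j) ?_ ?_ ?_ ?_
  · intro j hj
    have : j ≤ n / m := by simpa [Nat.lt_succ_iff] using hj
    have := (Nat.le_div_iff_mul_le hm).1 this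
    rw [mul_comm] at this
    simp only [Finset.mem_filter, Finset.mem_range, dvd_mul_right, and_true]
    omega
  · intro a _ b _ h
    exact Nat.eq_of_mul_eq_mul_left hm h
  · intro b hb
    simp only [Finset.mem_filter, Finset.mem_range] at hb
    refine ⟨b / m, ?_, Nat.mul_div_cancel' hb.2⟩
    have : b / m ≤ n / m := Nat.div_le_div_right (by omega)
    simp only [Finset.mem_range]
    omega
  · intro j _
    rw [Nat.mul_div_cancel_left _ hm, div_mul_div_comm]

lemma egf_lam (R : ℂ) (m : ℕ) (x y : ℂ) : egf (fun n => GHlam R m n x y) =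
    egf (fun j => (-1) ^ j * cR R j) * egf (fun n => gouldHopper m n x y) := by
  rw [egf_mul]
  congr 1
  funext n
  simp only [GHlam, mul_assoc]

lemma egf_pow (x z : ℂ) : egf (fun n => (x + z) ^ n) = egf (fun n => z ^ n) * egf (fun n => x ^ n) := by
  rw [egf_mul]
  congr 1
  funext n
  rw [add_comm, add_pow]
  exact Finset.sum_congr rfl fun j _ => by ring

/-- Summation formula for the Gould–Hopper-λ-matrix polynomials:
`_{H^m}λ_n^R(x+z,y) = Σ_{j=0}^n (n choose j) z^j _{H^m}λ_{n-j}^R(x,y)`. -/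
theorem GHlam_add (R : ℂ) (hR : 0 < R.re) (m : ℕ) (hm : 1 ≤ m) (n : ℕ) (x y z : ℂ) :
    GHlam R m n (x + z) y =
      ∑ j ∈ Finset.range (n + 1), (n.choose j : ℂ) * z ^ j * GHlam R m (n - j) x y := by
  have key : egf (fun n => GHlam R m n (x + z) y) =
      egf (fun n => z ^ n) * egf (fun n => GHlam R m n x y) := by
    rw [egf_lam, egf_lam, egf_gh m hm, egf_gh m hm, egf_pow]
    ring
  rw [egf_mul] at key
  exact egf_inj key n
end

section
/- The truncated exponential-λ-matrix polynomials satisfy the two-index identity: for all j, l ∈ ℕ and x, y, z ∈ ℂ, _eλ_{j+l}^R(z, y) = Σ_{n=0}^j Σ_{r=0}^l (j choose n)(l choose r)(z − x)^{n+r} · _eλ_{j+l−n−r}^R(x, y). -/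
/-- The truncated exponential polynomials of order 1:
`e_n(x,y) = n! Σ_{j=0}^n x^{n-j} y^j/(n-j)!`. -/
noncomputable def truncExp (n : ℕ) (x y : ℂ) : ℂ :=
  (n.factorial : ℂ) * ∑ j ∈ Finset.range (n + 1), x ^ (n - j) * y ^ j / ((n - j).factorial : ℂ)

/-- The truncated exponential-λ-matrix polynomials
`_elam_n^R(x,y) = Σ_{j=0}^n (n choose j) (-1)^j c_R(j) e_{n-j}(x,y)`. -/
noncomputable def elam (R : ℂ) (n : ℕ) (x y : ℂ) : ℂ :=
  ∑ j ∈ Finset.range (n + 1), (n.choose j : ℂ) * (-1) ^ j * cR R j * truncExp (n - j) x y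

open Polynomial in
/-- umbral functional in two variables -/
noncomputable def umb (a b : ℕ → ℂ) : ℂ[X][X] →ₗ[ℂ] ℂ :=
  Polynomial.lsum (fun k => b k • Polynomial.lsum (fun i => a i • (LinearMap.id : ℂ →ₗ[ℂ] ℂ)))

open Polynomial in
theorem umb_mono (a b : ℕ → ℂ) (i k : ℕ) (c : ℂ) :
    umb a b (C (X ^ i) * (X ^ k * C (C c))) = c * a i * b k := by
  have : (C (X ^ i) * (X ^ k * C (C c)) : ℂ[X][X]) = monomial k (monomial i c) := by
    rw [← C_mul_X_pow_eq_monomial, ← C_mul_X_pow_eq_monomial, C_mul]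
    ring
  rw [this]
  simp [umb, Polynomial.lsum_apply, Polynomial.sum_monomial_index]
  ring

theorem truncExp_eq (n : ℕ) (x y : ℂ) :
    truncExp n x y = ∑ k ∈ Finset.range (n + 1), (n.choose k : ℂ) * x ^ (n - k) * (k.factorial * y ^ k) := by
  unfold truncExp
  rw [Finset.mul_sum]
  refine Finset.sum_congr rfl fun k hk => ?_
  have hk' : k ≤ n := by simpa [Nat.lt_succ_iff] using hk
  have h := Nat.choose_mul_factorial_mul_factorial hk'
  have h0 : ((n - k).factorial : ℂ) ≠ 0 := by exact_mod_cast Nat.factorial_ne_zero _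
  rw [← h]
  push_cast
  field_simp

open Polynomial in
theorem elam_umb (R : ℂ) (n : ℕ) (x y : ℂ) :
    elam R n x y = umb (fun i => (-1) ^ i * cR R i) (fun k => k.factorial * y ^ k)
      ((C X + (X + C (C x))) ^ n) := by
  rw [add_pow, map_sum]
  unfold elam
  refine Finset.sum_congr rfl fun i _ => ?_
  rw [add_pow, truncExp_eq, Finset.mul_sum, Finset.mul_sum, Finset.sum_mul, map_sum]
  refine Finset.sum_congr rfl fun k _ => ?_
  have : (C X ^ i * (X ^ k * C (C x) ^ (n - i - k) * (((n - i).choose k : ℕ) : ℂ[X][X])) * ((n.choose i : ℕ) : ℂ[X][X]))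
     = C (X ^ i) * (X ^ k * C (C (x ^ (n - i - k) * ((n - i).choose k : ℂ) * (n.choose i : ℂ)))) := by
    simp only [map_mul, map_pow, map_natCast]
    ring
  rw [this, umb_mono]
  ring

/-- Two-index identity for the truncated exponential-λ-matrix polynomials:
`_elam_{j+l}^R(z,y) = Σ_{n=0}^j Σ_{r=0}^l (j choose n)(l choose r)(z-x)^{n+r} _elam_{j+l-n-r}^R(x,y)`. -/
theorem elam_two_index (R : ℂ) (hR : 0 < R.re) (j l : ℕ) (x y z : ℂ) :
    elam R (j + l) z y =
      ∑ n ∈ Finset.range (j + 1), ∑ r ∈ Finset.range (l + 1),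
        (j.choose n : ℂ) * (l.choose r : ℂ) * (z - x) ^ (n + r) * elam R (j + l - n - r) x y := by
  rw [elam_umb]
  have key : ((Polynomial.C Polynomial.X + (Polynomial.X + Polynomial.C (Polynomial.C z))) ^ (j + l)
      : Polynomial (Polynomial ℂ)) =
      ∑ n ∈ Finset.range (j + 1), ∑ r ∈ Finset.range (l + 1),
        ((j.choose n : ℂ) * (l.choose r : ℂ) * (z - x) ^ (n + r)) •
          (Polynomial.C Polynomial.X + (Polynomial.X + Polynomial.C (Polynomial.C x)))
            ^ (j + l - n - r) := by
    have h : (Polynomial.C Polynomial.X + (Polynomial.X + Polynomial.C (Polynomial.C z))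
        : Polynomial (Polynomial ℂ)) = Polynomial.C (Polynomial.C (z - x)) +
        (Polynomial.C Polynomial.X + (Polynomial.X + Polynomial.C (Polynomial.C x))) := by
      simp only [map_sub]
      ring
    rw [h, pow_add, add_pow, add_pow, Finset.sum_mul_sum]
    refine Finset.sum_congr rfl fun n hn => Finset.sum_congr rfl fun r hr => ?_
    have e : j + l - n - r = (j - n) + (l - r) := by
      simp only [Finset.mem_range] at hn hr
      omega
    rw [e, Algebra.smul_def]
    simp only [Polynomial.algebraMap_apply, Algebra.algebraMap_self_apply, map_mul, map_pow,
      map_natCast]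
    ring
  rw [key, map_sum]
  refine Finset.sum_congr rfl fun n _ => ?_
  rw [map_sum]
  refine Finset.sum_congr rfl fun r _ => ?_
  rw [map_smul, elam_umb, smul_eq_mul]
end
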